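/- arXiv:2207.01027 — 2 statements merged into one kernel-verified Lean document; each statement's English description precedes it below -/
import Mathlib

section
/- Let q be a prime power, let N, k, m, h be integers with 1 ≤ k ≤ N, 1 ≤ m ≤ N−k, 1 ≤ h ≤ m−1 and h+1 ≤ k, and let A be a nonempty partial m-spread of F_q^N. Then the number of k-dimensional (A,h)-scattered F_q-subspaces of F_q^N is at most [N choose k]_q − |A|·∂_q(N,k,m,h)² / (∂_q(N,k,m,h) + (|A|−1)·ω_q(N,k,m,h)), as an inequality of rational numbers. -/
/-- The Gaussian binomial coefficient `[a choose b]_q`, defined via the `q`-Pascal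
recursion; it equals the number of `b`-dimensional `F_q`-subspaces of `F_q^a`. -/
def gaussBinomNat (q : ℕ) : ℕ → ℕ → ℕ
  | _, 0 => 1
  | 0, _ + 1 => 0
  | a + 1, b + 1 => gaussBinomNat q a b + q ^ (b + 1) * gaussBinomNat q a (b + 1)

/-- The Gaussian binomial coefficient with integer indices, with the convention that it
vanishes when `b < 0` or `b > a`. -/
def gaussBinom (q : ℕ) (a b : ℤ) : ℤ :=
  if 0 ≤ b ∧ b ≤ a then gaussBinomNat q a.toNat b.toNat else 0

/-- The quantity `∂_q(N,k,m,h)`: the number of `k`-spaces of `F_q^N` meeting a fixed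
`m`-space in dimension at least `h+1`. -/
def partialDelta (q N k m h : ℕ) : ℤ :=
  ∑ l ∈ Finset.Icc (h + 1) m, ∑ b ∈ Finset.Icc l m,
    gaussBinom q m l * gaussBinom q ((m : ℤ) - l) ((b : ℤ) - l) *
      gaussBinom q ((N : ℤ) - b) ((k : ℤ) - b) * (-1) ^ (b - l) *
      (q : ℤ) ^ ((b - l) * (b - l - 1) / 2)

/-- The quantity `ω_q(N,k,m,h)`: the number of `k`-spaces of `F_q^N` meeting two fixed
disjoint `m`-spaces both in dimension at least `h+1`. -/
def omegaCount (q N k m h : ℕ) : ℤ :=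
  ∑ l ∈ Finset.Icc (h + 1) m, ∑ l' ∈ Finset.Icc (h + 1) m,
    gaussBinom q m l * gaussBinom q m l' *
      ∑ r ∈ Finset.Icc l m, ∑ s ∈ Finset.Icc l' m,
        gaussBinom q ((m : ℤ) - l) ((r : ℤ) - l) * gaussBinom q ((m : ℤ) - l') ((s : ℤ) - l') *
          gaussBinom q ((N : ℤ) - r - s) ((k : ℤ) - r - s) * (-1) ^ (r + s - l - l') *
          (q : ℤ) ^ ((r - l) * (r - l - 1) / 2 + (s - l') * (s - l' - 1) / 2)

theorem gaussBinomNat_eq_zero (q : ℕ) {a b : ℕ} (h : a < b) : gaussBinomNat q a b = 0 := by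
  induction a generalizing b with
  | zero => obtain _ | b := b <;> simp [gaussBinomNat] at h ⊢
  | succ a ih =>
    obtain _ | b := b
    · omega
    · rw [gaussBinomNat, ih (by omega), ih (by omega)]; simp

theorem gaussBinomNat_zero_right (q a : ℕ) : gaussBinomNat q a 0 = 1 := by
  cases a <;> rfl

theorem gaussBinomNat_self (q a : ℕ) : gaussBinomNat q a a = 1 := by
  induction a with
  | zero => rfl
  | succ a ih => rw [gaussBinomNat, ih, gaussBinomNat_eq_zero q (Nat.lt_succ_self a)]; simp

theorem gaussBinom_natCast (q a b : ℕ) : gaussBinom q a b = gaussBinomNat q a b := by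
  unfold gaussBinom
  split_ifs with h
  · simp
  · rw [gaussBinomNat_eq_zero q (by omega)]; simp

theorem gaussBinom_sub {q a b c : ℕ} (ha : c ≤ a) (hb : c ≤ b) :
    gaussBinom q ((a : ℤ) - c) ((b : ℤ) - c) = gaussBinomNat q (a - c) (b - c) := by
  rw [← Nat.cast_sub ha, ← Nat.cast_sub hb, gaussBinom_natCast]

theorem prod_pow_sub_pow_succ (x : ℤ) (n k : ℕ) :
    ∏ i ∈ Finset.range (k + 1), (x ^ (n + 1) - x ^ i) =
      (x ^ (n + 1) - 1) * x ^ k * ∏ i ∈ Finset.range k, (x ^ n - x ^ i) := by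
  rw [Finset.prod_range_succ']
  have : ∀ i ∈ Finset.range k, x ^ (n + 1) - x ^ (i + 1) = x * (x ^ n - x ^ i) := by
    intros; ring
  rw [Finset.prod_congr rfl this, Finset.prod_mul_distrib]
  simp
  ring

theorem gaussBinomNat_mul_prod (q n k : ℕ) :
    (gaussBinomNat q n k : ℤ) * ∏ i ∈ Finset.range k, ((q : ℤ) ^ k - (q : ℤ) ^ i) =
      ∏ i ∈ Finset.range k, ((q : ℤ) ^ n - (q : ℤ) ^ i) := by
  induction n generalizing k with
  | zero =>
    obtain _ | k := k
    · simp [gaussBinomNat]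
    · simp [gaussBinomNat, Finset.prod_range_succ']
  | succ n ih =>
    obtain _ | k := k
    · simp [gaussBinomNat]
    · have h1 := ih k
      have h2 := ih (k + 1)
      rw [gaussBinomNat]
      push_cast
      rw [add_mul, mul_assoc ((q : ℤ) ^ (k + 1)), h2, prod_pow_sub_pow_succ, prod_pow_sub_pow_succ,
        Finset.prod_range_succ]
      linear_combination ((q : ℤ) ^ (k + 1) - 1) * (q : ℤ) ^ k * h1

theorem finrank_map_mkQ_add {F V : Type*} [Field F] [AddCommGroup V] [Module F V]
    [FiniteDimensional F V] {B U : Submodule F V} (h : B ≤ U) :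
    Module.finrank F (U.map B.mkQ) + Module.finrank F B = Module.finrank F U := by
  have := LinearMap.finrank_range_add_finrank_ker (B.mkQ.domRestrict U)
  rw [LinearMap.range_domRestrict, LinearMap.ker_domRestrict, Submodule.ker_mkQ] at this
  rw [← this, (Submodule.comapSubtypeEquivOfLe h).finrank_eq]

section Counting

variable {F V : Type*} [Field F] [Fintype F] [AddCommGroup V] [Module F V] [Finite V]

/-- A linearly independent `k`-tuple with span `U` is a linearly independent `k`-tuple of `U`,
when `U` has dimension `k`. -/
def linearIndependentSpanEquiv (U : Submodule F V) {k : ℕ} (hU : Module.finrank F U = k) :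
    {s : {s : Fin k → V // LinearIndependent F s} // Submodule.span F (Set.range s.1) = U} ≃
      {t : Fin k → U // LinearIndependent F t} where
  toFun s := ⟨fun i => ⟨s.1.1 i, s.2.le (Submodule.subset_span ⟨i, rfl⟩)⟩,
    LinearIndependent.of_comp U.subtype s.1.2⟩
  invFun t := ⟨⟨fun i => t.1 i, t.2.map' U.subtype U.ker_subtype⟩, by
    have h := t.2.map' U.subtype U.ker_subtype
    refine Submodule.eq_of_le_of_finrank_eq ?_ ?_
    · rw [Submodule.span_le]
      rintro _ ⟨i, rfl⟩
      exact (t.1 i).2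
    · rw [hU]
      exact (finrank_span_eq_card h).trans (Fintype.card_fin k)⟩
  left_inv s := rfl
  right_inv t := rfl

theorem natCard_linearIndependent_eq_prod {k : ℕ} (hk : k ≤ Module.finrank F V) :
    (Nat.card {s : Fin k → V // LinearIndependent F s} : ℤ) =
      ∏ i ∈ Finset.range k,
        ((Fintype.card F : ℤ) ^ Module.finrank F V - (Fintype.card F : ℤ) ^ i) := by
  rw [card_linearIndependent hk, Finset.prod_range, Nat.cast_prod]
  refine Finset.prod_congr rfl fun i _ => ?_
  rw [Nat.cast_sub (Nat.pow_le_pow_right Fintype.card_pos (by omega))]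
  simp

/-- The Gaussian binomial coefficient counts the subspaces of a given dimension. -/
theorem natCard_submodule_finrank_eq (k : ℕ) :
    Nat.card {U : Submodule F V // Module.finrank F U = k} =
      gaussBinomNat (Fintype.card F) (Module.finrank F V) k := by
  rcases lt_or_ge (Module.finrank F V) k with h | hk
  · rw [gaussBinomNat_eq_zero _ h, Nat.card_eq_zero]
    left
    exact ⟨fun U => by have := Submodule.finrank_le U.1; have := U.2; omega⟩
  have := Fintype.ofFinite {U : Submodule F V // Module.finrank F U = k}
  have key : Nat.card {s : Fin k → V // LinearIndependent F s} =
      ∑ U : {U : Submodule F V // Module.finrank F U = k},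
        Nat.card {t : Fin k → U.1 // LinearIndependent F t} := by
    rw [Nat.card_congr (Equiv.sigmaFiberEquiv
      (fun s : {s : Fin k → V // LinearIndependent F s} =>
        (⟨Submodule.span F (Set.range s.1),
          (finrank_span_eq_card s.2).trans (Fintype.card_fin k)⟩ :
          {U : Submodule F V // Module.finrank F U = k}))).symm, Nat.card_sigma]
    refine Finset.sum_congr rfl fun U _ => Nat.card_congr ?_
    exact (Equiv.subtypeEquivRight fun s => Subtype.ext_iff).trans
      (linearIndependentSpanEquiv U.1 U.2)
  have key' := congrArg (Nat.cast : ℕ → ℤ) key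
  rw [natCard_linearIndependent_eq_prod hk, Nat.cast_sum, Finset.sum_congr rfl (fun U _ => by
    rw [natCard_linearIndependent_eq_prod U.2.ge, U.2]), Finset.sum_const, nsmul_eq_mul,
    Finset.card_univ,
    ← Nat.card_eq_fintype_card (α := {U : Submodule F V // Module.finrank F U = k}),
    ← gaussBinomNat_mul_prod] at key'
  have hne : ∏ i ∈ Finset.range k, ((Fintype.card F : ℤ) ^ k - (Fintype.card F : ℤ) ^ i) ≠ 0 := by
    rw [Finset.prod_ne_zero_iff]
    intro i hi
    have := Nat.pow_lt_pow_right (Fintype.one_lt_card (α := F)) (Finset.mem_range.1 hi)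
    rw [sub_ne_zero]
    exact_mod_cast this.ne'
  exact_mod_cast (mul_right_cancel₀ hne key').symm

theorem natCard_submodule_le (S : Submodule F V) (k : ℕ) :
    Nat.card {U : Submodule F V // Module.finrank F U = k ∧ U ≤ S} =
      gaussBinomNat (Fintype.card F) (Module.finrank F S) k := by
  rw [← natCard_submodule_finrank_eq]
  refine Nat.card_congr (Equiv.symm ?_)
  refine (Equiv.subtypeEquiv (Submodule.MapSubtype.orderIso S).toEquiv
    (q := fun U => Module.finrank F U.1 = k) fun W => ?_).trans
    ((Equiv.subtypeSubtypeEquivSubtypeInter _ fun U : Submodule F V =>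
      Module.finrank F U = k).trans (Equiv.subtypeEquivRight fun _ => and_comm))
  have := Submodule.finrank_map_subtype_eq S W
  change _ ↔ Module.finrank F (W.map S.subtype) = k
  rw [this]

theorem natCard_le_submodule (B : Submodule F V) (k : ℕ) (hk : Module.finrank F B ≤ k) :
    Nat.card {U : Submodule F V // Module.finrank F U = k ∧ B ≤ U} =
      gaussBinomNat (Fintype.card F) (Module.finrank F V - Module.finrank F B)
        (k - Module.finrank F B) := by
  have := Finite.of_surjective B.mkQ B.mkQ_surjective
  have hq := B.finrank_quotient_add_finrank
  rw [← hq, Nat.add_sub_cancel, ← natCard_submodule_finrank_eq]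
  refine Nat.card_congr (Equiv.symm ?_)
  refine (Equiv.subtypeEquiv (Submodule.comapMkQRelIso B).toEquiv
    (q := fun U => Module.finrank F U.1 = k) fun W => ?_).trans
    ((Equiv.subtypeSubtypeEquivSubtypeInter _ fun U : Submodule F V =>
      Module.finrank F U = k).trans (Equiv.subtypeEquivRight fun _ => and_comm))
  change _ ↔ Module.finrank F (W.comap B.mkQ) = k
  have := finrank_map_mkQ_add (Submodule.le_comap_mkQ B W)
  rw [Submodule.map_comap_eq_self (by simp)] at this
  omega

/-- Counting triples `(R, S, U)` with `R ≤ A`, `S ≤ B`, `R ⊔ S ≤ U` and `dim R = r`, `dim S = s`,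
`dim U = k`, for disjoint `A` and `B`. -/
theorem sum_gaussBinomNat_inf_mul {k : ℕ} (hk : k ≤ Module.finrank F V)
    (T : Finset (Submodule F V)) (hT : ∀ U, U ∈ T ↔ Module.finrank F U = k)
    (A B : Submodule F V) (hAB : A ⊓ B = ⊥) (r s : ℕ) :
    ∑ U ∈ T, (gaussBinomNat (Fintype.card F) (Module.finrank F ↥(U ⊓ A)) r : ℤ) *
        gaussBinomNat (Fintype.card F) (Module.finrank F ↥(U ⊓ B)) s =
      gaussBinomNat (Fintype.card F) (Module.finrank F A) r *
        gaussBinomNat (Fintype.card F) (Module.finrank F B) s *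
        gaussBinom (Fintype.card F) ((Module.finrank F V : ℤ) - r - s) ((k : ℤ) - r - s) := by
  classical
  have := Fintype.ofFinite (Submodule F V)
  let P (C : Submodule F V) (t : ℕ) : Finset (Submodule F V) :=
    Finset.univ.filter fun R => Module.finrank F R = t ∧ R ≤ C
  have hP (C : Submodule F V) (t : ℕ) :
      gaussBinomNat (Fintype.card F) (Module.finrank F C) t = (P C t).card := by
    rw [← natCard_submodule_le, Nat.subtype_card (P C t) (by simp [P])]
  have hfib (p : Submodule F V × Submodule F V) (hp : p ∈ P A r ×ˢ P B s) :
      ((Finset.bipartiteBelow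
        (fun (U : Submodule F V) (p : Submodule F V × Submodule F V) => p.1 ⊔ p.2 ≤ U)
        T p).card : ℤ) =
        gaussBinom (Fintype.card F) ((Module.finrank F V : ℤ) - r - s) ((k : ℤ) - r - s) := by
    rw [Finset.bipartiteBelow]
    simp only [P, Finset.mem_product, Finset.mem_filter, Finset.mem_univ, true_and] at hp
    obtain ⟨⟨h1, h1'⟩, h2, h2'⟩ := hp
    have hd : Module.finrank F ↥(p.1 ⊔ p.2) = r + s := by
      have h := Submodule.finrank_sup_add_finrank_inf_eq p.1 p.2
      rw [le_bot_iff.1 ((inf_le_inf h1' h2').trans hAB.le), finrank_bot, h1, h2] at h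
      exact h
    rw [sub_sub, sub_sub, ← Nat.cast_add]
    rcases le_or_gt (r + s) k with hrs | hrs
    · rw [gaussBinom_sub (hrs.trans hk) hrs, ← hd,
        ← natCard_le_submodule (p.1 ⊔ p.2) k (hd.trans_le hrs),
        Nat.subtype_card (T.filter fun U => p.1 ⊔ p.2 ≤ U) (by simp [hT])]
    · rw [gaussBinom, if_neg (by omega), Nat.cast_eq_zero, Finset.card_eq_zero,
        Finset.filter_eq_empty_iff]
      intro U hU hle
      have := Submodule.finrank_mono hle
      rw [hd, (hT U).1 hU] at this
      omega
  have hswap := Finset.sum_card_bipartiteAbove_eq_sum_card_bipartiteBelow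
    (s := T) (t := P A r ×ˢ P B s) fun U p => p.1 ⊔ p.2 ≤ U
  calc _ = ((∑ U ∈ T, (Finset.bipartiteAbove
          (fun (U : Submodule F V) (p : Submodule F V × Submodule F V) => p.1 ⊔ p.2 ≤ U)
          (P A r ×ˢ P B s) U).card : ℕ) : ℤ) := by
        rw [Nat.cast_sum]
        refine Finset.sum_congr rfl fun U _ => ?_
        rw [hP, hP, ← Nat.cast_mul, ← Finset.card_product]
        congr 2
        ext p
        simp only [P, Finset.mem_product, Finset.mem_filter, Finset.mem_univ, true_and,
          Finset.mem_bipartiteAbove, le_inf_iff, sup_le_iff]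
        tauto
    _ = _ := by
        rw [hswap, Nat.cast_sum, Finset.sum_congr rfl hfib, Finset.sum_const, nsmul_eq_mul,
          Finset.card_product, hP, hP, Nat.cast_mul]

theorem sum_gaussBinomNat_inf {k : ℕ} (hk : k ≤ Module.finrank F V)
    (T : Finset (Submodule F V)) (hT : ∀ U, U ∈ T ↔ Module.finrank F U = k)
    (A : Submodule F V) (r : ℕ) :
    ∑ U ∈ T, (gaussBinomNat (Fintype.card F) (Module.finrank F ↥(U ⊓ A)) r : ℤ) =
      gaussBinomNat (Fintype.card F) (Module.finrank F A) r *
        gaussBinom (Fintype.card F) ((Module.finrank F V : ℤ) - r) ((k : ℤ) - r) := by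
  simpa [gaussBinomNat_zero_right] using
    sum_gaussBinomNat_inf_mul hk T hT A ⊥ (inf_bot_eq A) r 0

end Counting

theorem gaussBinomNat_mul_gaussBinomNat (F : Type*) [Field F] [Fintype F] {n k b : ℕ}
    (hk : k ≤ n) (hb : b ≤ k) :
    gaussBinomNat (Fintype.card F) n k * gaussBinomNat (Fintype.card F) k b =
      gaussBinomNat (Fintype.card F) n b * gaussBinomNat (Fintype.card F) (n - b) (k - b) := by
  classical
  have := Fintype.ofFinite (Submodule F (Fin n → F))
  let T : Finset (Submodule F (Fin n → F)) := Finset.univ.filter fun U => Module.finrank F U = k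
  have hT : ∀ U, U ∈ T ↔ Module.finrank F U = k := by simp [T]
  have hn : Module.finrank F (Fin n → F) = n := Module.finrank_fin_fun F
  have h := sum_gaussBinomNat_inf (hk.trans hn.ge) T hT ⊤ b
  rw [Finset.sum_congr rfl (fun U hU => by rw [inf_top_eq, (hT U).1 hU]), Finset.sum_const,
    finrank_top, hn, gaussBinom_sub (hb.trans hk) hb, ← Nat.subtype_card T hT,
    natCard_submodule_finrank_eq, hn, nsmul_eq_mul] at h
  exact_mod_cast h

/-- The coefficients `(-1) ^ j * q ^ (j choose 2)` of Gaussian binomial inversion. -/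
def gaussMoebius (q j : ℕ) : ℤ := (-1) ^ j * (q : ℤ) ^ (j * (j - 1) / 2)

theorem gaussMoebius_succ (q j : ℕ) :
    gaussMoebius q (j + 1) = -((q : ℤ) ^ j * gaussMoebius q j) := by
  have : (j + 1) * (j + 1 - 1) / 2 = j + j * (j - 1) / 2 := by
    rw [← Nat.choose_two_right, ← Nat.choose_two_right, Nat.choose_succ_succ' j 1]
    simp
  rw [gaussMoebius, gaussMoebius, this, pow_succ, pow_add]
  ring

theorem sum_gaussBinomNat_succ_mul_gaussMoebius (q n M : ℕ) :
    ∑ j ∈ Finset.range (M + 1), (gaussBinomNat q (n + 1) j : ℤ) * gaussMoebius q j =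
      (q : ℤ) ^ M * gaussBinomNat q n M * gaussMoebius q M := by
  induction M with
  | zero => simp [gaussBinomNat_zero_right]
  | succ M ih =>
    rw [Finset.sum_range_succ, ih, gaussBinomNat, gaussMoebius_succ]
    push_cast
    ring

theorem sum_gaussBinomNat_mul_gaussMoebius (q : ℕ) {n M : ℕ} (h : n ≤ M) :
    ∑ j ∈ Finset.range (M + 1), (gaussBinomNat q n j : ℤ) * gaussMoebius q j =
      if n = 0 then 1 else 0 := by
  obtain _ | n := n
  · rw [Finset.sum_range_succ', Finset.sum_eq_zero fun j _ => by simp [gaussBinomNat]]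
    simp [gaussBinomNat, gaussMoebius]
  · rw [sum_gaussBinomNat_succ_mul_gaussMoebius, gaussBinomNat_eq_zero q (show n < M by omega)]
    simp

/-- Gaussian binomial inversion. -/
theorem sum_gaussBinomNat_inversion (F : Type*) [Field F] [Fintype F] {d l m : ℕ}
    (hd : d ≤ m) (hl : l ≤ m) :
    ∑ b ∈ Finset.Icc l m, (gaussBinomNat (Fintype.card F) d b : ℤ) *
        gaussBinomNat (Fintype.card F) b l * gaussMoebius (Fintype.card F) (b - l) =
      if d = l then 1 else 0 := by
  rcases lt_or_ge d l with hdl | hld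
  · rw [if_neg hdl.ne]
    refine Finset.sum_eq_zero fun b hb => ?_
    rw [gaussBinomNat_eq_zero _ (hdl.trans_le (Finset.mem_Icc.1 hb).1)]
    simp
  · have hterm : ∀ b ∈ Finset.Icc l m, (gaussBinomNat (Fintype.card F) d b : ℤ) *
        gaussBinomNat (Fintype.card F) b l * gaussMoebius (Fintype.card F) (b - l) =
        gaussBinomNat (Fintype.card F) d l * (gaussBinomNat (Fintype.card F) (d - l) (b - l) *
          gaussMoebius (Fintype.card F) (b - l)) := by
      intro b hb
      have hlb := (Finset.mem_Icc.1 hb).1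
      rw [← mul_assoc]
      congr 1
      rcases le_or_gt b d with hbd | hbd
      · exact_mod_cast gaussBinomNat_mul_gaussBinomNat F hbd hlb
      · rw [gaussBinomNat_eq_zero _ hbd,
          gaussBinomNat_eq_zero _ (show d - l < b - l by omega)]
        simp
    rw [Finset.sum_congr rfl hterm, ← Finset.mul_sum, ← Finset.Ico_succ_right_eq_Icc,
      Finset.sum_Ico_eq_sum_range]
    simp only [Nat.add_sub_cancel_left]
    rw [show Order.succ m - l = m - l + 1 by rw [Nat.succ_eq_succ]; omega,
      sum_gaussBinomNat_mul_gaussMoebius _ (show d - l ≤ m - l by omega)]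
    rcases eq_or_ne d l with rfl | hne
    · rw [if_pos (Nat.sub_self d), if_pos rfl]
      simp [gaussBinomNat_self]
    · rw [if_neg (by omega), if_neg hne, mul_zero]

theorem sum_sum_gaussBinomNat_inversion (F : Type*) [Field F] [Fintype F] {d m : ℕ} (h : ℕ)
    (hd : d ≤ m) :
    ∑ l ∈ Finset.Icc (h + 1) m, ∑ b ∈ Finset.Icc l m,
        (gaussBinomNat (Fintype.card F) d b : ℤ) * gaussBinomNat (Fintype.card F) b l *
          gaussMoebius (Fintype.card F) (b - l) =
      if h + 1 ≤ d then 1 else 0 := by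
  rw [Finset.sum_congr rfl fun l hl =>
    sum_gaussBinomNat_inversion F hd (Finset.mem_Icc.1 hl).2, Finset.sum_ite_eq]
  simp [hd]

theorem partialDelta_eq_sum {F V : Type*} [Field F] [Fintype F] [AddCommGroup V] [Module F V]
    [Finite V] {k : ℕ} (h : ℕ) (hk : k ≤ Module.finrank F V)
    (T : Finset (Submodule F V)) (hT : ∀ U, U ∈ T ↔ Module.finrank F U = k)
    (A : Submodule F V) :
    partialDelta (Fintype.card F) (Module.finrank F V) k (Module.finrank F A) h =
      ∑ U ∈ T, if h + 1 ≤ Module.finrank F ↥(U ⊓ A) then 1 else 0 := by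
  rw [Finset.sum_congr rfl fun U _ => (sum_sum_gaussBinomNat_inversion F h
    (Submodule.finrank_mono (inf_le_right : U ⊓ A ≤ A))).symm, Finset.sum_comm]
  refine Finset.sum_congr rfl fun l hl => ?_
  rw [Finset.sum_comm]
  refine Finset.sum_congr rfl fun b hb => ?_
  rw [Finset.mem_Icc] at hb
  have hflag := gaussBinomNat_mul_gaussBinomNat F hb.2 hb.1
  rw [← Finset.sum_mul, ← Finset.sum_mul, sum_gaussBinomNat_inf hk T hT, gaussBinom_natCast,
    gaussBinom_sub (hb.1.trans hb.2) hb.1, ← Nat.cast_mul, ← hflag, gaussMoebius]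
  push_cast
  ring

theorem omegaCount_eq_sum {F V : Type*} [Field F] [Fintype F] [AddCommGroup V] [Module F V]
    [Finite V] {k m : ℕ} (h : ℕ) (hk : k ≤ Module.finrank F V)
    (T : Finset (Submodule F V)) (hT : ∀ U, U ∈ T ↔ Module.finrank F U = k)
    (A B : Submodule F V) (hA : Module.finrank F A = m) (hB : Module.finrank F B = m)
    (hAB : A ⊓ B = ⊥) :
    omegaCount (Fintype.card F) (Module.finrank F V) k m h =
      ∑ U ∈ T, (if h + 1 ≤ Module.finrank F ↥(U ⊓ A) then 1 else 0) *
        (if h + 1 ≤ Module.finrank F ↥(U ⊓ B) then 1 else 0) := by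
  have hle (U C : Submodule F V) (hC : Module.finrank F C = m) :
      Module.finrank F ↥(U ⊓ C) ≤ m :=
    hC ▸ Submodule.finrank_mono (inf_le_right : U ⊓ C ≤ C)
  have hU (U : Submodule F V) : ((if h + 1 ≤ Module.finrank F ↥(U ⊓ A) then 1 else 0) *
      (if h + 1 ≤ Module.finrank F ↥(U ⊓ B) then 1 else 0) : ℤ) =
      ∑ l ∈ Finset.Icc (h + 1) m, ∑ l' ∈ Finset.Icc (h + 1) m,
        ∑ r ∈ Finset.Icc l m, ∑ s ∈ Finset.Icc l' m,
          ((gaussBinomNat (Fintype.card F) (Module.finrank F ↥(U ⊓ A)) r : ℤ) *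
              gaussBinomNat (Fintype.card F) (Module.finrank F ↥(U ⊓ B)) s) *
            (gaussBinomNat (Fintype.card F) r l * gaussBinomNat (Fintype.card F) s l') *
            (gaussMoebius (Fintype.card F) (r - l) * gaussMoebius (Fintype.card F) (s - l')) := by
    rw [← sum_sum_gaussBinomNat_inversion F h (hle U A hA),
      ← sum_sum_gaussBinomNat_inversion F h (hle U B hB), Finset.sum_mul_sum]
    refine Finset.sum_congr rfl fun l _ => Finset.sum_congr rfl fun l' _ => ?_
    rw [Finset.sum_mul_sum]
    refine Finset.sum_congr rfl fun r _ => Finset.sum_congr rfl fun s _ => ?_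
    ring
  simp only [hU]
  rw [Finset.sum_comm]
  refine Finset.sum_congr rfl fun l hl => ?_
  rw [Finset.sum_comm]
  refine Finset.sum_congr rfl fun l' hl' => ?_
  rw [Finset.sum_comm (s := T), Finset.mul_sum]
  refine Finset.sum_congr rfl fun r hr => ?_
  rw [Finset.sum_comm (s := T), Finset.mul_sum]
  refine Finset.sum_congr rfl fun s hs => ?_
  rw [Finset.mem_Icc] at hr hs
  have hflag := gaussBinomNat_mul_gaussBinomNat F hr.2 hr.1
  have hflag' := gaussBinomNat_mul_gaussBinomNat F hs.2 hs.1
  have hcount := sum_gaussBinomNat_inf_mul hk T hT A B hAB r s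
  rw [hA, hB] at hcount
  have hexp : r + s - l - l' = (r - l) + (s - l') := by omega
  rw [← Finset.sum_mul, ← Finset.sum_mul, hcount,
    gaussBinom_natCast, gaussBinom_natCast, gaussBinom_sub (hr.1.trans hr.2) hr.1,
    gaussBinom_sub (hs.1.trans hs.2) hs.1, gaussMoebius, gaussMoebius, hexp, pow_add, pow_add]
  zify at hflag hflag'
  linear_combination (-1) * (gaussBinom (Fintype.card F) ((Module.finrank F V : ℤ) - r - s)
    ((k : ℤ) - r - s) * (-1) ^ (r - l) * (-1) ^ (s - l') *
    (Fintype.card F : ℤ) ^ ((r - l) * (r - l - 1) / 2) *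
    (Fintype.card F : ℤ) ^ ((s - l') * (s - l' - 1) / 2)) *
    (gaussBinomNat (Fintype.card F) m s * gaussBinomNat (Fintype.card F) s l' * hflag +
      gaussBinomNat (Fintype.card F) m l * gaussBinomNat (Fintype.card F) (m - l) (r - l) * hflag')

/-- For a nonempty partial `m`-spread `A` of `F_q^N`, `1 ≤ h ≤ m-1`,
`h+1 ≤ k`, the number of `k`-dimensional `(A,h)`-scattered subspaces of `F_q^N` is at
most `[N choose k]_q − |A|·∂² / (∂ + (|A|−1)·ω)`, as rational numbers. -/
theorem stmt_13 (q N k m h : ℕ) (hq : IsPrimePow q)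
    (hk1 : 1 ≤ k) (hkN : k ≤ N) (hm1 : 1 ≤ m) (hm : m ≤ N - k)
    (hh1 : 1 ≤ h) (hhm : h ≤ m - 1) (hhk : h + 1 ≤ k)
    (F : Type) [Field F] [Fintype F] (hF : Fintype.card F = q)
    (A : Set (Submodule F (Fin N → F))) (hAne : A.Nonempty)
    (hAdim : ∀ S ∈ A, Module.finrank F S = m)
    (hAint : ∀ S ∈ A, ∀ T ∈ A, S ≠ T → S ⊓ T = ⊥) :
    (Nat.card {U : Submodule F (Fin N → F) //
        Module.finrank F U = k ∧ ∀ S ∈ A, Module.finrank F ↥(U ⊓ S) ≤ h} : ℚ) ≤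
      (gaussBinom q N k : ℚ) -
        (Set.ncard A : ℚ) * (partialDelta q N k m h : ℚ) ^ 2 /
          ((partialDelta q N k m h : ℚ) +
            ((Set.ncard A : ℚ) - 1) * (omegaCount q N k m h : ℚ)) := by
  classical
  subst hF
  have := Fintype.ofFinite (Submodule F (Fin N → F))
  have hn : Module.finrank F (Fin N → F) = N := Module.finrank_fin_fun F
  have hkV : k ≤ Module.finrank F (Fin N → F) := hkN.trans hn.ge
  obtain ⟨A, rfl⟩ : ∃ B : Finset (Submodule F (Fin N → F)), (B : Set _) = A :=
    ⟨A.toFinite.toFinset, by simp⟩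
  simp only [Finset.mem_coe] at hAdim hAint ⊢
  rw [Set.ncard_coe_finset]
  let T : Finset (Submodule F (Fin N → F)) := Finset.univ.filter fun U => Module.finrank F U = k
  have hT : ∀ U, U ∈ T ↔ Module.finrank F U = k := by simp [T]
  let χ (S U : Submodule F (Fin N → F)) : ℤ :=
    if h + 1 ≤ Module.finrank F ↥(U ⊓ S) then 1 else 0
  have hδ (S) (hS : S ∈ A) : ∑ U ∈ T, χ S U = partialDelta (Fintype.card F) N k m h := by
    have := partialDelta_eq_sum h hkV T hT S
    rw [hn, hAdim S hS] at this
    exact this.symm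
  have hω (S) (hS : S ∈ A) (S') (hS' : S' ∈ A) (hne : S ≠ S') :
      ∑ U ∈ T, χ S U * χ S' U = omegaCount (Fintype.card F) N k m h := by
    have := omegaCount_eq_sum h hkV T hT S S' (hAdim S hS) (hAdim S' hS') (hAint S hS S' hS' hne)
    rw [hn] at this
    exact this.symm
  set δ := partialDelta (Fintype.card F) N k m h
  set ω := omegaCount (Fintype.card F) N k m h
  let X (U : Submodule F (Fin N → F)) : ℤ := ∑ S ∈ A, χ S U
  have hX1 : ∑ U ∈ T, X U = A.card * δ := by
    rw [Finset.sum_comm, Finset.sum_congr rfl hδ, Finset.sum_const, nsmul_eq_mul]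
  have hX2 : ∑ U ∈ T, X U ^ 2 = A.card * (δ + (A.card - 1) * ω) := by
    simp only [X, sq, Finset.sum_mul_sum]
    rw [Finset.sum_comm, Finset.sum_congr rfl (g := fun _ => δ + (A.card - 1) * ω),
      Finset.sum_const, nsmul_eq_mul]
    intro S hS
    rw [Finset.sum_comm, ← Finset.add_sum_erase A _ hS]
    congr 1
    · rw [← hδ S hS]
      refine Finset.sum_congr rfl fun U _ => ?_
      simp only [χ]
      split_ifs <;> simp
    · rw [Finset.sum_congr rfl fun S' hS' => hω S hS S' (Finset.mem_of_mem_erase hS')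
        (Finset.ne_of_mem_erase hS').symm, Finset.sum_const, nsmul_eq_mul,
        Finset.card_erase_of_mem hS, Nat.cast_pred (Finset.card_pos.2 ⟨S, hS⟩)]
  let P (U : Submodule F (Fin N → F)) : Prop := ∀ S ∈ A, Module.finrank F ↥(U ⊓ S) ≤ h
  have hXP (U) (hU : P U) : X U = 0 :=
    Finset.sum_eq_zero fun S hS => if_neg (by have := hU S hS; omega)
  have hcard : (T.filter P).card + (T.filter fun U => ¬ P U).card =
      gaussBinomNat (Fintype.card F) N k := by
    rw [Finset.card_filter_add_card_filter_not, ← Nat.subtype_card T hT,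
      natCard_submodule_finrank_eq, hn]
  rw [Nat.subtype_card (T.filter P) (by simp [T, P]), gaussBinom_natCast, ← hcard]
  have hcs := sq_sum_le_card_mul_sum_sq (s := T.filter fun U => ¬ P U) (f := X)
  rw [Finset.sum_filter_of_ne (p := fun U => ¬ P U) fun U _ hne hU => hne (hXP U hU),
    Finset.sum_filter_of_ne (p := fun U => ¬ P U) fun U _ hne hU => hne (by rw [hXP U hU]; rfl),
    hX1, hX2] at hcs
  have hpos : 0 < (A.card : ℤ) := by exact_mod_cast Finset.card_pos.2 hAne
  have hD : 0 ≤ δ + (A.card - 1) * ω := by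
    refine nonneg_of_mul_nonneg_right (a := (A.card : ℤ)) ?_ hpos
    exact hX2 ▸ Finset.sum_nonneg fun U _ => sq_nonneg _
  have hle : A.card * δ ^ 2 ≤ (T.filter fun U => ¬ P U).card * (δ + (A.card - 1) * ω) := by
    refine le_of_mul_le_mul_left ?_ hpos
    linarith
  have hdiv : (A.card : ℚ) * (δ : ℚ) ^ 2 / ((δ : ℚ) + ((A.card : ℚ) - 1) * (ω : ℚ)) ≤
      (T.filter fun U => ¬ P U).card :=
    div_le_of_le_mul₀ (by exact_mod_cast hD) (Nat.cast_nonneg _) (by exact_mod_cast hle)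
  push_cast
  linarith
end

section
/- Let q be a prime power, let m, t be positive integers, and let X = F_{q^m}^{2t}, regarded as an F_q-vector space of dimension 2tm. Let U = {(x_1, x_1^q, x_2, x_2^q, …, x_t, x_t^q) : x_1, …, x_t ∈ F_{q^m}}. Then U is an F_q-subspace of X with dim_{F_q}(U) = mt, and for every nonzero vector v ∈ X one has dim_{F_q}(U ∩ ⟨v⟩_{F_{q^m}}) ≤ 1; that is, U is a scattered subspace of dimension m·(2t)/2 = mt with respect to the Desarguesian m-spread of X (a maximum scattered subspace). -/
open Polynomial in
/-- An element of an extension `E` of the finite field `F` fixed by the `F`-Frobenius lies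
in `F`. -/
theorem FiniteField.exists_algebraMap_eq_of_pow_card_eq {F E : Type*} [Field F] [Fintype F]
    [Field E] [Algebra F E] {c : E} (hc : c ^ Fintype.card F = c) :
    ∃ a : F, algebraMap F E a = c := by
  classical
  have hne : (X ^ Fintype.card F - X : E[X]) ≠ 0 :=
    FiniteField.X_pow_card_sub_X_ne_zero E Fintype.one_lt_card
  have hsub : Finset.univ.image (algebraMap F E) ⊆
      (X ^ Fintype.card F - X : E[X]).roots.toFinset := by
    intro y hy
    obtain ⟨a, -, rfl⟩ := Finset.mem_image.mp hy
    simp [hne, ← map_pow, FiniteField.pow_card]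
  have hcard : (X ^ Fintype.card F - X : E[X]).roots.toFinset.card ≤
      (Finset.univ.image (algebraMap F E)).card := by
    rw [Finset.card_image_of_injective _ (algebraMap F E).injective, Finset.card_univ]
    refine (Multiset.toFinset_card_le _).trans ((card_roots' _).trans ?_)
    rw [FiniteField.X_pow_card_sub_X_natDegree_eq E Fintype.one_lt_card]
  have hmem : c ∈ (X ^ Fintype.card F - X : E[X]).roots.toFinset := by
    simp [hne, hc]
  rw [← Finset.eq_of_subset_of_card_le hsub hcard] at hmem
  simpa using hmem

/-- The `F`-linear map `(x_1, …, x_t) ↦ (x_1, x_1^q, …, x_t, x_t^q)`, where `q = |F|`. -/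
noncomputable def frobeniusInterleave (F E : Type*) [Field F] [Fintype F] [Field E]
    [Algebra F E] (t : ℕ) : (Fin t → E) →ₗ[F] (Fin (2 * t) → E) :=
  LinearMap.pi fun j =>
    (if j.val % 2 = 0 then LinearMap.id else (FiniteField.frobeniusAlgHom F E).toLinearMap) ∘ₗ
      LinearMap.proj (⟨j.val / 2, by have := j.isLt; omega⟩ : Fin t)

section frobeniusInterleave

variable {F E : Type*} [Field F] [Fintype F] [Field E] [Algebra F E] {t : ℕ}

theorem frobeniusInterleave_even (x : Fin t → E) (i : Fin t) (h : 2 * i.val < 2 * t) :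
    frobeniusInterleave F E t x ⟨2 * i.val, h⟩ = x i := by
  simp [frobeniusInterleave]

theorem frobeniusInterleave_odd (x : Fin t → E) (i : Fin t) (h : 2 * i.val + 1 < 2 * t) :
    frobeniusInterleave F E t x ⟨2 * i.val + 1, h⟩ = x i ^ Fintype.card F := by
  have h2 : (2 * i.val + 1) / 2 = i.val := by omega
  simp [frobeniusInterleave, h2, Nat.add_mod]

theorem frobeniusInterleave_injective :
    Function.Injective (frobeniusInterleave F E t) := by
  intro x y hxy
  funext i
  have h : 2 * i.val < 2 * t := by have := i.isLt; omega
  rw [← frobeniusInterleave_even (F := F) x i h, hxy, frobeniusInterleave_even]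

theorem frobeniusInterleave_eq_iff (v : Fin (2 * t) → E) (x : Fin t → E) :
    frobeniusInterleave F E t x = v ↔ ∀ i : Fin t,
      v ⟨2 * i.val, by have := i.isLt; omega⟩ = x i ∧
      v ⟨2 * i.val + 1, by have := i.isLt; omega⟩ = x i ^ Fintype.card F := by
  constructor
  · rintro rfl i
    exact ⟨frobeniusInterleave_even _ _ _, frobeniusInterleave_odd _ _ _⟩
  · intro h
    funext ⟨j, hj⟩
    obtain ⟨k, rfl | rfl⟩ := Nat.even_or_odd' j
    · exact (frobeniusInterleave_even x ⟨k, by omega⟩ hj).trans (h ⟨k, by omega⟩).1.symm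
    · exact (frobeniusInterleave_odd x ⟨k, by omega⟩ hj).trans (h ⟨k, by omega⟩).2.symm

/-- If `c • u = w` for an `E`-scalar `c` and vectors `u ≠ 0`, `w` in the range of
`frobeniusInterleave`, then `c` lies in `F`. -/
theorem exists_algebraMap_eq_of_smul_frobeniusInterleave {x y : Fin t → E} {c : E}
    (hx : x ≠ 0) (h : c • frobeniusInterleave F E t x = frobeniusInterleave F E t y) :
    ∃ a : F, algebraMap F E a = c := by
  obtain ⟨i, hi⟩ := Function.ne_iff.mp hx
  have h0 : c * x i = y i := by
    have := congrFun h ⟨2 * i.val, by have := i.isLt; omega⟩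
    rwa [Pi.smul_apply, frobeniusInterleave_even, frobeniusInterleave_even] at this
  have h1 : c * x i ^ Fintype.card F = y i ^ Fintype.card F := by
    have := congrFun h ⟨2 * i.val + 1, by have := i.isLt; omega⟩
    rwa [Pi.smul_apply, frobeniusInterleave_odd, frobeniusInterleave_odd] at this
  rw [← h0, mul_pow] at h1
  exact FiniteField.exists_algebraMap_eq_of_pow_card_eq
    (mul_right_cancel₀ (pow_ne_zero _ hi) h1).symm

theorem finrank_range_frobeniusInterleave_inf_span_le_one (v : Fin (2 * t) → E) :
    Module.finrank F ↥(LinearMap.range (frobeniusInterleave F E t) ⊓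
      (Submodule.span E {v}).restrictScalars F) ≤ 1 := by
  set S := LinearMap.range (frobeniusInterleave F E t) ⊓
    (Submodule.span E {v}).restrictScalars F
  by_cases hS : ∃ u : S, u ≠ 0
  · obtain ⟨⟨u, ⟨x, rfl⟩, hu⟩, hne⟩ := hS
    have hne' : frobeniusInterleave F E t x ≠ 0 := fun h => hne (Subtype.ext h)
    refine finrank_le_one ⟨_, ⟨x, rfl⟩, hu⟩ ?_
    rintro ⟨w, ⟨y, rfl⟩, hw⟩
    obtain ⟨a, ha⟩ := Submodule.mem_span_singleton.mp hu
    obtain ⟨b, hb⟩ := Submodule.mem_span_singleton.mp hw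
    have ha0 : a ≠ 0 := by
      rintro rfl
      exact hne' (by rw [← ha, zero_smul])
    have hab : (b / a) • frobeniusInterleave F E t x = frobeniusInterleave F E t y := by
      rw [← ha, ← hb, smul_smul, div_mul_cancel₀ _ ha0]
    obtain ⟨c, hc⟩ := exists_algebraMap_eq_of_smul_frobeniusInterleave
      (fun h => hne' (by rw [h, map_zero])) hab
    refine ⟨c, Subtype.ext ?_⟩
    change c • frobeniusInterleave F E t x = frobeniusInterleave F E t y
    rw [← hab, ← hc, algebraMap_smul]
  · push Not at hS
    exact finrank_le_one 0 fun w => ⟨0, by rw [hS w, smul_zero]⟩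

end frobeniusInterleave


/-- Let `X = F_{q^m}^(2t)` and
`U = {(x_1, x_1^q, x_2, x_2^q, …, x_t, x_t^q) : x_1, …, x_t ∈ F_{q^m}}` (coordinates
`2i` and `2i+1` of a vector of `U` are `x_i` and `x_i^q` respectively). Then `U` is an
`F_q`-subspace of `X` with `dim_{F_q} U = m·t`, and for every nonzero `v ∈ X` one has
`dim_{F_q}(U ∩ ⟨v⟩_{F_{q^m}}) ≤ 1`; that is, `U` is a scattered subspace of dimension
`m·(2t)/2 = m·t` with respect to the Desarguesian `m`-spread of `X` (a maximum
scattered subspace). -/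
theorem stmt_19 (q m t : ℕ) (hq : IsPrimePow q) (hm : 0 < m) (ht : 0 < t)
    (F : Type) [Field F] [Fintype F] (hF : Fintype.card F = q)
    (E : Type) [Field E] [Algebra F E] (hE : Module.finrank F E = m) :
    ∃ U : Submodule F (Fin (2 * t) → E),
      (U : Set (Fin (2 * t) → E)) =
        {v : Fin (2 * t) → E | ∃ x : Fin t → E, ∀ i : Fin t,
          v ⟨2 * i.val, by have := i.isLt; omega⟩ = x i ∧
          v ⟨2 * i.val + 1, by have := i.isLt; omega⟩ = x i ^ q} ∧
      Module.finrank F U = m * t ∧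
      ∀ v : Fin (2 * t) → E, v ≠ 0 →
        Module.finrank F ↥(U ⊓ (Submodule.span E {v}).restrictScalars F) ≤ 1 := by
  subst hF
  have : FiniteDimensional F E := Module.finite_of_finrank_pos (hE ▸ hm)
  refine ⟨LinearMap.range (frobeniusInterleave F E t), ?_, ?_, fun v _ =>
    finrank_range_frobeniusInterleave_inf_span_le_one v⟩
  · ext v
    exact exists_congr fun x => frobeniusInterleave_eq_iff v x
  · rw [LinearMap.finrank_range_of_inj frobeniusInterleave_injective,
      Module.finrank_pi_fintype]
    simp [hE, mul_comm]
end
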